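/- Let a∈[0,1]², q≥0 and t∈ℝ with t < γ(q), where γ is the moment scaling function. Then there exists a constant K>0 (depending on t and q but not on δ) such that Σ_{𝔦∈𝓘_{a,δ}} ψ^{t,q}_a(𝔦) ≥ K for all δ∈(0,1], where 𝓘_{a,δ} = {𝔦∈𝓘* : α₂(D_aS_𝔦) < δ ≤ α₂(D_aS_{𝔦̂})} is the δ-stopping and 𝔦̂ denotes 𝔦 with its last letter deleted. -/

import Mathlib

/-!
Setting (Falconer–Fraser–Lee, "L^q-spectra of measures on planar non-conformal attractors"):
a finite family of C^{1+α} skew-product contractions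
`S i (x,y) = (f i x, g i (x,y))` of the unit square, satisfying a domination
condition on the (lower triangular) Jacobians.
-/

open Set Filter Topology MeasureTheory
open scoped Classical ENNReal

noncomputable section

/-- The closed unit square `[0,1]² ⊆ ℝ²`. -/
def unitSq : Set (ℝ × ℝ) := Set.Icc (0:ℝ) 1 ×ˢ Set.Icc (0:ℝ) 1

variable {ι : Type*} [Fintype ι]

/-- The skew-product map `S_i(x,y) = (f_i x, g_i (x,y))`. -/
def Smap (f : ι → ℝ → ℝ) (g : ι → ℝ × ℝ → ℝ) (i : ι) : ℝ × ℝ → ℝ × ℝ :=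
  fun a => (f i a.1, g i a)

/-- The composition `S_𝔦 = S_{i₁} ∘ ⋯ ∘ S_{i_k}` along a finite word `𝔦 = [i₁, …, i_k]`. -/
def Sword (f : ι → ℝ → ℝ) (g : ι → ℝ × ℝ → ℝ) : List ι → ℝ × ℝ → ℝ × ℝ
  | [] => id
  | i :: l => Smap f g i ∘ Sword f g l

/-- The first component `f_𝔦 = f_{i₁} ∘ ⋯ ∘ f_{i_k}` of `S_𝔦` (a function of `x` only). -/
def fword (f : ι → ℝ → ℝ) : List ι → ℝ → ℝ
  | [] => id
  | i :: l => f i ∘ fword f l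

/-- Top-left entry `f_{𝔦,x}(a)` of the (lower triangular) Jacobian `D_a S_𝔦`. -/
def fxw (f : ι → ℝ → ℝ) (g : ι → ℝ × ℝ → ℝ) (l : List ι) (a : ℝ × ℝ) : ℝ :=
  deriv (fun x => (Sword f g l (x, a.2)).1) a.1

/-- Bottom-left entry `g_{𝔦,x}(a)` of the Jacobian `D_a S_𝔦`. -/
def gxw (f : ι → ℝ → ℝ) (g : ι → ℝ × ℝ → ℝ) (l : List ι) (a : ℝ × ℝ) : ℝ :=
  deriv (fun x => (Sword f g l (x, a.2)).2) a.1

/-- Bottom-right entry `g_{𝔦,y}(a)` of the Jacobian `D_a S_𝔦`. -/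
def gyw (f : ι → ℝ → ℝ) (g : ι → ℝ × ℝ → ℝ) (l : List ι) (a : ℝ × ℝ) : ℝ :=
  deriv (fun y => (Sword f g l (a.1, y)).2) a.2

/-- The standing hypotheses: `|𝓘| ≥ 2`; each `S_i(x,y) = (f_i x, g_i(x,y))` maps the unit
square into itself; `f_i, g_i` are `C^{1+α}` contractions (`0 < α ≤ 1`); and the
domination condition `inf f_{i,x} > sup g_{i,y} ≥ inf g_{i,y} ≥ d > 0` holds. -/
structure IFSHyp (f : ι → ℝ → ℝ) (g : ι → ℝ × ℝ → ℝ) (α d : ℝ) : Prop where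
  card2 : 2 ≤ Fintype.card ι
  alpha_pos : 0 < α
  alpha_le_one : α ≤ 1
  d_pos : 0 < d
  maps_f : ∀ i, Set.MapsTo (f i) (Set.Icc 0 1) (Set.Icc 0 1)
  maps_g : ∀ i, Set.MapsTo (g i) unitSq (Set.Icc 0 1)
  diff_f : ∀ i, Differentiable ℝ (f i)
  diff_g : ∀ i, Differentiable ℝ (g i)
  holder_f : ∀ i, ∃ H : ℝ, ∀ x ∈ Set.Icc (0:ℝ) 1, ∀ y ∈ Set.Icc (0:ℝ) 1,
      |deriv (f i) x - deriv (f i) y| ≤ H * |x - y| ^ α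
  holder_g : ∀ i, ∃ H : ℝ, ∀ a ∈ unitSq, ∀ b ∈ unitSq,
      ‖fderiv ℝ (g i) a - fderiv ℝ (g i) b‖ ≤ H * ‖a - b‖ ^ α
  contr_f : ∀ i, ∃ c, 0 ≤ c ∧ c < 1 ∧ ∀ x ∈ Set.Icc (0:ℝ) 1, ∀ y ∈ Set.Icc (0:ℝ) 1,
      |f i x - f i y| ≤ c * |x - y|
  contr_g : ∀ i, ∃ c, 0 ≤ c ∧ c < 1 ∧ ∀ a ∈ unitSq, ∀ b ∈ unitSq,
      |g i a - g i b| ≤ c * ‖a - b‖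
  dom : ∀ i, sSup (gyw f g [i] '' unitSq) < sInf (fxw f g [i] '' unitSq)
  dom_d : ∀ i, ∀ a ∈ unitSq, d ≤ gyw f g [i] a

/-- The larger singular value of the lower triangular matrix `A = [[a,0],[b,c]]`, i.e. the
square root of the larger eigenvalue of `AᵀA`, in explicit closed form. -/
def sv1 (a b c : ℝ) : ℝ :=
  Real.sqrt (((a ^ 2 + b ^ 2 + c ^ 2) +
    Real.sqrt ((a ^ 2 + b ^ 2 + c ^ 2) ^ 2 - 4 * (a * c) ^ 2)) / 2)

/-- The smaller singular value of the lower triangular matrix `A = [[a,0],[b,c]]`, i.e. the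
square root of the smaller eigenvalue of `AᵀA`, in explicit closed form. -/
def sv2 (a b c : ℝ) : ℝ :=
  Real.sqrt (((a ^ 2 + b ^ 2 + c ^ 2) -
    Real.sqrt ((a ^ 2 + b ^ 2 + c ^ 2) ^ 2 - 4 * (a * c) ^ 2)) / 2)

/-- `α₁(D_a S_𝔦)`, the larger singular value of the Jacobian. -/
def alphaOne (f : ι → ℝ → ℝ) (g : ι → ℝ × ℝ → ℝ) (l : List ι) (a : ℝ × ℝ) : ℝ :=
  sv1 (fxw f g l a) (gxw f g l a) (gyw f g l a)

/-- `α₂(D_a S_𝔦)`, the smaller singular value of the Jacobian. -/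
def alphaTwo (f : ι → ℝ → ℝ) (g : ι → ℝ × ℝ → ℝ) (l : List ι) (a : ℝ × ℝ) : ℝ :=
  sv2 (fxw f g l a) (gxw f g l a) (gyw f g l a)

/-- `η = sup_{i, a, b} g_{i,y}(a) / f_{i,x}(b)`. -/
def etaSup (f : ι → ℝ → ℝ) (g : ι → ℝ × ℝ → ℝ) : ℝ :=
  sSup {x : ℝ | ∃ i : ι, ∃ a ∈ unitSq, ∃ b ∈ unitSq, x = gyw f g [i] a / fxw f g [i] b}

/-- `p(𝔦) = p_{i₁} ⋯ p_{i_k}`. -/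
def pword (p : ι → ℝ) (l : List ι) : ℝ := (l.map p).prod

/-- `(p_i)` is a probability vector with all entries in `(0,1)`. -/
def ProbVec (p : ι → ℝ) : Prop := (∀ i, 0 < p i ∧ p i < 1) ∧ ∑ i, p i = 1

/-- The `q`-modified singular value function
`ψ^{s,q}_a(𝔦) = p(𝔦)^q α₁(D_aS_𝔦)^βq α₂(D_aS_𝔦)^(s−βq)` (real exponents). -/
def psiSV (f : ι → ℝ → ℝ) (g : ι → ℝ × ℝ → ℝ) (p : ι → ℝ) (s q βq : ℝ)
    (a : ℝ × ℝ) (l : List ι) : ℝ :=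
  pword p l ^ q * alphaOne f g l a ^ βq * alphaTwo f g l a ^ (s - βq)

/-- `Ψ^{s,q}_{a,k} = Σ_{𝔦 ∈ 𝓘^k} ψ^{s,q}_a(𝔦)`. -/
def PsiSum (f : ι → ℝ → ℝ) (g : ι → ℝ × ℝ → ℝ) (p : ι → ℝ) (s q βq : ℝ)
    (a : ℝ × ℝ) (k : ℕ) : ℝ :=
  ∑ w : Fin k → ι, psiSV f g p s q βq a (List.ofFn w)

/-- The `δ`-stopping `𝓘_{a,δ} = {𝔦 : α₂(D_aS_𝔦) < δ ≤ α₂(D_aS_𝔦̂)}`, where `𝔦̂` drops the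
last letter of `𝔦`. -/
def stopping (f : ι → ℝ → ℝ) (g : ι → ℝ × ℝ → ℝ) (a : ℝ × ℝ) (δ : ℝ) : Set (List ι) :=
  {l | l ≠ [] ∧ alphaTwo f g l a < δ ∧ δ ≤ alphaTwo f g l.dropLast a}

/-- `q`-th power moment sum of a measure on `ℝ` over the `δ`-mesh intervals of positive
measure. -/
def msum1 (ν : Measure ℝ) (q δ : ℝ) : ℝ :=
  ∑' k : ℤ, if 0 < ν (Set.Icc ((k : ℝ) * δ) (((k : ℝ) + 1) * δ)) then
    (ν (Set.Icc ((k : ℝ) * δ) (((k : ℝ) + 1) * δ))).toReal ^ q else 0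

/-- `q`-th power moment sum of a measure on `ℝ²` over the `δ`-mesh squares of positive
measure. -/
def msum2 (ν : Measure (ℝ × ℝ)) (q δ : ℝ) : ℝ :=
  ∑' k : ℤ × ℤ,
    if 0 < ν (Set.Icc ((k.1 : ℝ) * δ) (((k.1 : ℝ) + 1) * δ) ×ˢ
        Set.Icc ((k.2 : ℝ) * δ) (((k.2 : ℝ) + 1) * δ)) then
      (ν (Set.Icc ((k.1 : ℝ) * δ) (((k.1 : ℝ) + 1) * δ) ×ˢ
        Set.Icc ((k.2 : ℝ) * δ) (((k.2 : ℝ) + 1) * δ))).toReal ^ q else 0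

/-- Upper `L^q`-spectrum of a measure on `ℝ²`. -/
def upperTau2 (ν : Measure (ℝ × ℝ)) (q : ℝ) : ℝ :=
  limsup (fun δ => Real.log (msum2 ν q δ) / (-Real.log δ)) (𝓝[>] (0:ℝ))

/-- Lower `L^q`-spectrum of a measure on `ℝ²`. -/
def lowerTau2 (ν : Measure (ℝ × ℝ)) (q : ℝ) : ℝ :=
  liminf (fun δ => Real.log (msum2 ν q δ) / (-Real.log δ)) (𝓝[>] (0:ℝ))


section Derivatives

variable {ι : Type*}

lemma Sword_append (f : ι → ℝ → ℝ) (g : ι → ℝ × ℝ → ℝ) (u v : List ι) (a : ℝ × ℝ) :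
    Sword f g (u ++ v) a = Sword f g u (Sword f g v a) := by
  induction u with
  | nil => rfl
  | cons i u ih => simp [Sword, ih]

lemma Sword_fst (f : ι → ℝ → ℝ) (g : ι → ℝ × ℝ → ℝ) (l : List ι) (a : ℝ × ℝ) :
    (Sword f g l a).1 = fword f l a.1 := by
  induction l with
  | nil => rfl
  | cons i l ih => simp [Sword, fword, Smap, ih]

variable {f : ι → ℝ → ℝ} {g : ι → ℝ × ℝ → ℝ}

lemma differentiable_Sword (hf : ∀ i, Differentiable ℝ (f i)) (hg : ∀ i, Differentiable ℝ (g i))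
    (l : List ι) : Differentiable ℝ (Sword f g l) := by
  induction l with
  | nil => exact differentiable_id
  | cons i l ih =>
    have : Differentiable ℝ (Smap f g i) :=
      ((hf i).comp differentiable_fst).prodMk (hg i)
    exact this.comp ih

lemma fxw_nil (a : ℝ × ℝ) : fxw f g [] a = 1 := by simp [fxw, Sword]

lemma gxw_nil (a : ℝ × ℝ) : gxw f g [] a = 0 := by simp [gxw, Sword]

lemma gyw_nil (a : ℝ × ℝ) : gyw f g [] a = 1 := by simp [gyw, Sword]

lemma fxw_singleton (i : ι) (a : ℝ × ℝ) : fxw f g [i] a = deriv (f i) a.1 := by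
  simp [fxw, Sword, Smap]

lemma gxw_singleton (hg : ∀ i, Differentiable ℝ (g i)) (i : ι) (a : ℝ × ℝ) :
    gxw f g [i] a = fderiv ℝ (g i) a (1, 0) := by
  have h1 : HasDerivAt (fun x : ℝ => ((x, a.2) : ℝ × ℝ)) (1, 0) a.1 :=
    (hasDerivAt_id a.1).prodMk (hasDerivAt_const a.1 a.2)
  exact (((hg i) a).hasFDerivAt.comp_hasDerivAt (f := fun x : ℝ => ((x, a.2) : ℝ × ℝ)) a.1 h1).deriv

lemma gyw_singleton (hg : ∀ i, Differentiable ℝ (g i)) (i : ι) (a : ℝ × ℝ) :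
    gyw f g [i] a = fderiv ℝ (g i) a (0, 1) := by
  have h1 : HasDerivAt (fun y : ℝ => ((a.1, y) : ℝ × ℝ)) (0, 1) a.2 :=
    (hasDerivAt_const a.2 a.1).prodMk (hasDerivAt_id a.2)
  exact (((hg i) a).hasFDerivAt.comp_hasDerivAt (f := fun y : ℝ => ((a.1, y) : ℝ × ℝ)) a.2 h1).deriv

lemma hasDerivAt_Sword_x (hf : ∀ i, Differentiable ℝ (f i)) (hg : ∀ i, Differentiable ℝ (g i))
    (l : List ι) (a : ℝ × ℝ) :
    HasDerivAt (fun x => Sword f g l (x, a.2)) (fxw f g l a, gxw f g l a) a.1 := by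
  have hd : Differentiable ℝ (fun x : ℝ => Sword f g l (x, a.2)) :=
    (differentiable_Sword hf hg l).comp (differentiable_id.prodMk (differentiable_const _))
  exact (hd.fst a.1).hasDerivAt.prodMk (hd.snd a.1).hasDerivAt

lemma hasDerivAt_Sword_y (hf : ∀ i, Differentiable ℝ (f i)) (hg : ∀ i, Differentiable ℝ (g i))
    (l : List ι) (a : ℝ × ℝ) :
    HasDerivAt (fun y => Sword f g l (a.1, y)) (0, gyw f g l a) a.2 := by
  have hd : Differentiable ℝ (fun y : ℝ => Sword f g l (a.1, y)) :=
    (differentiable_Sword hf hg l).comp ((differentiable_const _).prodMk differentiable_id)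
  have h0 : HasDerivAt (fun y => (Sword f g l (a.1, y)).1) 0 a.2 := by
    simp only [Sword_fst]
    exact hasDerivAt_const _ _
  exact h0.prodMk (hd.snd a.2).hasDerivAt

lemma fxw_cons (hf : ∀ i, Differentiable ℝ (f i)) (hg : ∀ i, Differentiable ℝ (g i))
    (i : ι) (l : List ι) (a : ℝ × ℝ) :
    fxw f g (i :: l) a = fxw f g [i] (Sword f g l a) * fxw f g l a := by
  have h1 := (hasDerivAt_Sword_x hf hg l a).fst
  rw [fxw_singleton]
  exact (HasDerivAt.comp a.1 (hf i _).hasDerivAt h1).deriv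

lemma gxw_cons (hf : ∀ i, Differentiable ℝ (f i)) (hg : ∀ i, Differentiable ℝ (g i))
    (i : ι) (l : List ι) (a : ℝ × ℝ) :
    gxw f g (i :: l) a = gxw f g [i] (Sword f g l a) * fxw f g l a +
      gyw f g [i] (Sword f g l a) * gxw f g l a := by
  have h1 := ((hg i) (Sword f g l a)).hasFDerivAt.comp_hasDerivAt
    (f := fun x => Sword f g l (x, a.2)) a.1 (hasDerivAt_Sword_x hf hg l a)
  rw [gxw_singleton hg, gyw_singleton hg]
  have h2 : ((fxw f g l a, gxw f g l a) : ℝ × ℝ)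
      = fxw f g l a • ((1, 0) : ℝ × ℝ) + gxw f g l a • ((0, 1) : ℝ × ℝ) := by simp
  rw [h2, map_add, map_smul, map_smul, smul_eq_mul, smul_eq_mul, mul_comm,
    mul_comm (gxw f g l a)] at h1
  exact h1.deriv

lemma gyw_cons (hf : ∀ i, Differentiable ℝ (f i)) (hg : ∀ i, Differentiable ℝ (g i))
    (i : ι) (l : List ι) (a : ℝ × ℝ) :
    gyw f g (i :: l) a = gyw f g [i] (Sword f g l a) * gyw f g l a := by
  have h1 := ((hg i) (Sword f g l a)).hasFDerivAt.comp_hasDerivAt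
    (f := fun y => Sword f g l (a.1, y)) a.2 (hasDerivAt_Sword_y hf hg l a)
  rw [gyw_singleton hg]
  have h2 : ((0, gyw f g l a) : ℝ × ℝ) = gyw f g l a • ((0, 1) : ℝ × ℝ) := by simp
  rw [h2, map_smul, smul_eq_mul, mul_comm] at h1
  exact h1.deriv

lemma append_of_cons {F : List ι → ℝ × ℝ → ℝ} (hnil : ∀ a, F [] a = 1)
    (hcons : ∀ i l a, F (i :: l) a = F [i] (Sword f g l a) * F l a) (u v : List ι) (a : ℝ × ℝ) :
    F (u ++ v) a = F u (Sword f g v a) * F v a := by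
  induction u with
  | nil => simp [hnil]
  | cons i u ih =>
    rw [List.cons_append, hcons, ih, hcons i u, Sword_append, mul_assoc]

end Derivatives

/-- Uniform constants for the system: domination ratio `η`, contraction ratio `c`,
Hölder constant `H`, and a bound `M` for the off-diagonal entries. -/
structure UniformBounds (f : ι → ℝ → ℝ) (g : ι → ℝ × ℝ → ℝ) (α d c η H M : ℝ) : Prop where
  c_pos : 0 < c
  c_lt_one : c < 1
  η_nonneg : 0 ≤ η
  η_lt_one : η < 1
  H_nonneg : 0 ≤ H
  M_nonneg : 0 ≤ M
  mapsTo : ∀ i, Set.MapsTo (Smap f g i) unitSq unitSq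
  le_gyw : ∀ i, ∀ a ∈ unitSq, d ≤ gyw f g [i] a
  gyw_le : ∀ i, ∀ a ∈ unitSq, gyw f g [i] a ≤ η * fxw f g [i] a
  fxw_le : ∀ i, ∀ a ∈ unitSq, fxw f g [i] a ≤ c
  gxw_le : ∀ i, ∀ a ∈ unitSq, |gxw f g [i] a| ≤ M
  holder_fxw : ∀ i, ∀ a ∈ unitSq, ∀ b ∈ unitSq,
    |fxw f g [i] a - fxw f g [i] b| ≤ H * ‖a - b‖ ^ α
  holder_gyw : ∀ i, ∀ a ∈ unitSq, ∀ b ∈ unitSq,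
    |gyw f g [i] a - gyw f g [i] b| ≤ H * ‖a - b‖ ^ α
  contr : ∀ i, ∀ a ∈ unitSq, ∀ b ∈ unitSq, ‖Smap f g i a - Smap f g i b‖ ≤ c * ‖a - b‖

lemma norm_sub_le_one_of_mem_unitSq {a b : ℝ × ℝ} (ha : a ∈ unitSq) (hb : b ∈ unitSq) :
    ‖a - b‖ ≤ 1 := by
  obtain ⟨⟨h1, h2⟩, h3, h4⟩ := ha
  obtain ⟨⟨h5, h6⟩, h7, h8⟩ := hb
  rw [Prod.norm_def, max_le_iff]
  simp only [Prod.fst_sub, Prod.snd_sub, Real.norm_eq_abs, abs_le]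
  refine ⟨⟨?_, ?_⟩, ?_, ?_⟩ <;> linarith

lemma abs_deriv_le_of_lipschitz_Icc {φ : ℝ → ℝ} {c : ℝ} (hφ : Differentiable ℝ φ)
    (hc : ∀ x ∈ Set.Icc (0:ℝ) 1, ∀ y ∈ Set.Icc (0:ℝ) 1, |φ x - φ y| ≤ c * |x - y|)
    {x : ℝ} (hx : x ∈ Set.Icc (0:ℝ) 1) : |deriv φ x| ≤ c := by
  have h1 : HasDerivWithinAt φ (deriv φ x) (Set.Icc 0 1) x := (hφ x).hasDerivAt.hasDerivWithinAt
  rw [hasDerivWithinAt_iff_tendsto_slope] at h1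
  have hne : (𝓝[Set.Icc (0:ℝ) 1 \ {x}] x).NeBot :=
    accPt_principal_iff_nhdsWithin.1
      (uniqueDiffWithinAt_iff_accPt.1 (uniqueDiffOn_Icc (zero_lt_one' ℝ) x hx))
  refine le_of_tendsto h1.abs ?_
  filter_upwards [self_mem_nhdsWithin] with y hy
  have hxy : 0 < |y - x| := abs_pos.2 (sub_ne_zero.2 hy.2)
  rw [slope_def_field, abs_div, div_le_iff₀ hxy]
  exact hc y hy.1 x hx

lemma exists_uniformBounds {f : ι → ℝ → ℝ} {g : ι → ℝ × ℝ → ℝ} {α d : ℝ}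
    (h : IFSHyp f g α d) : ∃ c η H M, UniformBounds f g α d c η H M := by
  choose cf hcf0 hcf1 hcf using h.contr_f
  choose cg hcg0 hcg1 hcg using h.contr_g
  choose Hf hHf using h.holder_f
  choose Hg hHg using h.holder_g
  have h0 : ((0, 0) : ℝ × ℝ) ∈ unitSq := by simp [unitSq]
  have hα := h.alpha_pos
  have hpow : ∀ a ∈ unitSq, ∀ b ∈ unitSq, ‖a - b‖ ^ α ≤ 1 := fun a ha b hb =>
    Real.rpow_le_one (norm_nonneg _) (norm_sub_le_one_of_mem_unitSq ha hb) hα.le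
  have hfd : ∀ i, ∀ a ∈ unitSq, ‖fderiv ℝ (g i) a‖ ≤ ‖fderiv ℝ (g i) (0, 0)‖ + |Hg i| := by
    intro i a ha
    have h1 := hHg i a ha _ h0
    have h2 := norm_le_norm_add_norm_sub' (fderiv ℝ (g i) a) (fderiv ℝ (g i) (0, 0))
    have h3 : Hg i * ‖a - (0, 0)‖ ^ α ≤ |Hg i| * 1 :=
      mul_le_mul (le_abs_self _) (hpow a ha _ h0) (by positivity) (abs_nonneg _)
    linarith
  have hgy : ∀ i, ∀ a ∈ unitSq, gyw f g [i] a ≤ ‖fderiv ℝ (g i) (0, 0)‖ + |Hg i| := by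
    intro i a ha
    rw [gyw_singleton h.diff_g]
    refine (le_abs_self _).trans (((fderiv ℝ (g i) a).le_opNorm _).trans ?_)
    simpa [Prod.norm_def] using hfd i a ha
  have hfx : ∀ i, ∀ a ∈ unitSq, |fxw f g [i] a| ≤ cf i := by
    intro i a ha
    rw [fxw_singleton]
    exact abs_deriv_le_of_lipschitz_Icc (h.diff_f i) (hcf i) ha.1
  have hS : ∀ i, ∀ a ∈ unitSq, gyw f g [i] a ≤ sSup (gyw f g [i] '' unitSq) := fun i a ha =>
    le_csSup ⟨_, by rintro _ ⟨b, hb, rfl⟩; exact hgy i b hb⟩ ⟨a, ha, rfl⟩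
  have hI : ∀ i, ∀ a ∈ unitSq, sInf (fxw f g [i] '' unitSq) ≤ fxw f g [i] a := fun i a ha =>
    csInf_le ⟨-cf i, by rintro _ ⟨b, hb, rfl⟩; exact (abs_le.1 (hfx i b hb)).1⟩ ⟨a, ha, rfl⟩
  have hSpos : ∀ i, 0 < sSup (gyw f g [i] '' unitSq) := fun i =>
    h.d_pos.trans_le ((h.dom_d i _ h0).trans (hS i _ h0))
  have hIpos : ∀ i, 0 < sInf (fxw f g [i] '' unitSq) := fun i => (hSpos i).trans (h.dom i)
  obtain ⟨c, hc, hc0, hc1⟩ : ∃ c : ℝ, (∀ i, cf i ≤ c ∧ cg i ≤ c) ∧ 0 < c ∧ c < 1 := by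
    have e1 : ∀ᶠ c in 𝓝[<] (1:ℝ), ∀ i, cf i ≤ c ∧ cg i ≤ c := by
      refine eventually_all.2 fun i => ?_
      have := (eventually_ge_nhds (hcf1 i)).and (eventually_ge_nhds (hcg1 i))
      exact this.filter_mono nhdsWithin_le_nhds
    have e2 : ∀ᶠ c in 𝓝[<] (1:ℝ), 0 < c :=
      (eventually_gt_nhds zero_lt_one).filter_mono nhdsWithin_le_nhds
    exact (e1.and (e2.and self_mem_nhdsWithin)).exists
  obtain ⟨η, hη, hη0, hη1⟩ : ∃ η : ℝ, (∀ i, sSup (gyw f g [i] '' unitSq) /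
      sInf (fxw f g [i] '' unitSq) ≤ η) ∧ 0 < η ∧ η < 1 := by
    have e1 : ∀ᶠ c in 𝓝[<] (1:ℝ), ∀ i, sSup (gyw f g [i] '' unitSq) /
      sInf (fxw f g [i] '' unitSq) ≤ c := by
      refine eventually_all.2 fun i => ?_
      exact (eventually_ge_nhds ((div_lt_one (hIpos i)).2 (h.dom i))).filter_mono
        nhdsWithin_le_nhds
    have e2 : ∀ᶠ c in 𝓝[<] (1:ℝ), 0 < c :=
      (eventually_gt_nhds zero_lt_one).filter_mono nhdsWithin_le_nhds
    exact (e1.and (e2.and self_mem_nhdsWithin)).exists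
  obtain ⟨H, hH, hH0⟩ : ∃ H : ℝ, (∀ i, |Hf i| ≤ H ∧ |Hg i| ≤ H) ∧ 0 ≤ H :=
    ((eventually_all.2 fun i => (eventually_ge_atTop |Hf i|).and
      (eventually_ge_atTop |Hg i|)).and (eventually_ge_atTop 0)).exists
  obtain ⟨M, hM, hM0⟩ : ∃ M : ℝ, (∀ i, ‖fderiv ℝ (g i) (0, 0)‖ + |Hg i| ≤ M) ∧ 0 ≤ M :=
    ((eventually_all.2 fun i => eventually_ge_atTop (‖fderiv ℝ (g i) (0, 0)‖ + |Hg i|)).and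
      (eventually_ge_atTop 0)).exists
  refine ⟨c, η, H, M, hc0, hc1, hη0.le, hη1, hH0, hM0, ?_, h.dom_d, ?_, ?_, ?_, ?_, ?_, ?_⟩
  · exact fun i a ha => ⟨h.maps_f i ha.1, h.maps_g i ha⟩
  · intro i a ha
    calc gyw f g [i] a ≤ sSup (gyw f g [i] '' unitSq) := hS i a ha
      _ ≤ η * sInf (fxw f g [i] '' unitSq) := (div_le_iff₀ (hIpos i)).1 (hη i)
      _ ≤ η * fxw f g [i] a := by gcongr; exact hI i a ha
  · exact fun i a ha => (le_abs_self _).trans ((hfx i a ha).trans (hc i).1)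
  · intro i a ha
    rw [gxw_singleton h.diff_g]
    refine ((fderiv ℝ (g i) a).le_opNorm _).trans ?_
    simpa [Prod.norm_def] using (hfd i a ha).trans (hM i)
  · intro i a ha b hb
    rw [fxw_singleton, fxw_singleton]
    refine (hHf i _ ha.1 _ hb.1).trans ?_
    have h1 : |a.1 - b.1| ≤ ‖a - b‖ := norm_fst_le (a - b)
    exact mul_le_mul ((le_abs_self _).trans (hH i).1)
      (Real.rpow_le_rpow (abs_nonneg _) h1 hα.le) (by positivity) hH0
  · intro i a ha b hb
    rw [gyw_singleton h.diff_g, gyw_singleton h.diff_g, ← sub_apply]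
    refine ((fderiv ℝ (g i) a - fderiv ℝ (g i) b).le_opNorm _).trans ?_
    have h1 : ‖((0, 1) : ℝ × ℝ)‖ = 1 := by simp [Prod.norm_def]
    rw [h1, mul_one]
    refine (hHg i a ha b hb).trans ?_
    gcongr
    exact (le_abs_self _).trans (hH i).2
  · intro i a ha b hb
    rw [Prod.norm_def, max_le_iff]
    constructor
    · refine (hcf i _ ha.1 _ hb.1).trans ?_
      exact mul_le_mul (hc i).1 (norm_fst_le (a - b)) (abs_nonneg _) hc0.le
    · refine (hcg i _ ha _ hb).trans ?_
      gcongr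
      exact (hc i).2

section Distortion

variable {ι : Type*} {f : ι → ℝ → ℝ} {g : ι → ℝ × ℝ → ℝ} {α d c η H M : ℝ}

lemma UniformBounds.Sword_mem (hB : UniformBounds f g α d c η H M) (l : List ι) {a : ℝ × ℝ}
    (ha : a ∈ unitSq) : Sword f g l a ∈ unitSq := by
  induction l with
  | nil => exact ha
  | cons i l ih => exact hB.mapsTo i ih

lemma UniformBounds.norm_Sword_sub_le (hB : UniformBounds f g α d c η H M) (l : List ι)
    {a b : ℝ × ℝ} (ha : a ∈ unitSq) (hb : b ∈ unitSq) :
    ‖Sword f g l a - Sword f g l b‖ ≤ c ^ l.length := by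
  induction l with
  | nil => simpa [Sword] using norm_sub_le_one_of_mem_unitSq ha hb
  | cons i l ih =>
    calc ‖Sword f g (i :: l) a - Sword f g (i :: l) b‖
        ≤ c * ‖Sword f g l a - Sword f g l b‖ :=
          hB.contr i _ (hB.Sword_mem l ha) _ (hB.Sword_mem l hb)
      _ ≤ c * c ^ l.length := by gcongr; exact hB.c_pos.le
      _ = c ^ (i :: l).length := by rw [List.length_cons, pow_succ']

lemma pos_of_cons (hB : UniformBounds f g α d c η H M) (hd : 0 < d)
    {F : List ι → ℝ × ℝ → ℝ} (hnil : ∀ a, F [] a = 1)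
    (hcons : ∀ i l a, F (i :: l) a = F [i] (Sword f g l a) * F l a)
    (hF : ∀ i, ∀ a ∈ unitSq, d ≤ F [i] a) (l : List ι) {a : ℝ × ℝ} (ha : a ∈ unitSq) :
    0 < F l a := by
  induction l with
  | nil => simp [hnil]
  | cons i l ih =>
    rw [hcons]
    exact mul_pos (hd.trans_le (hF i _ (hB.Sword_mem l ha))) ih

/-- Bounded distortion for multiplicative cocycles with Hölder generators. -/
lemma bounded_distortion (hB : UniformBounds f g α d c η H M) (hd : 0 < d) (hα : 0 < α)
    {F : List ι → ℝ × ℝ → ℝ} (hnil : ∀ a, F [] a = 1)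
    (hcons : ∀ i l a, F (i :: l) a = F [i] (Sword f g l a) * F l a)
    (hF : ∀ i, ∀ a ∈ unitSq, d ≤ F [i] a)
    (hH : ∀ i, ∀ a ∈ unitSq, ∀ b ∈ unitSq, |F [i] a - F [i] b| ≤ H * ‖a - b‖ ^ α) :
    ∃ L : ℝ, 1 ≤ L ∧ ∀ l : List ι, ∀ a ∈ unitSq, ∀ b ∈ unitSq, F l a ≤ L * F l b := by
  set r : ℝ := c ^ α with hr
  have hr0 : 0 ≤ r := Real.rpow_nonneg hB.c_pos.le _
  have hr1 : r < 1 := Real.rpow_lt_one hB.c_pos.le hB.c_lt_one hα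
  have hHd : 0 ≤ H / d := div_nonneg hB.H_nonneg hd.le
  have key : ∀ l : List ι, ∀ a ∈ unitSq, ∀ b ∈ unitSq,
      F l a ≤ Real.exp (H / d * ∑ j ∈ Finset.range l.length, r ^ j) * F l b := by
    intro l a ha b hb
    induction l with
    | nil => simp [hnil]
    | cons i l ih =>
      have hSa := hB.Sword_mem l ha
      have hSb := hB.Sword_mem l hb
      have hpow : ‖Sword f g l a - Sword f g l b‖ ^ α ≤ r ^ l.length := by
        calc ‖Sword f g l a - Sword f g l b‖ ^ α ≤ (c ^ l.length) ^ α :=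
              Real.rpow_le_rpow (norm_nonneg _) (hB.norm_Sword_sub_le l ha hb) hα.le
          _ = r ^ l.length := by
              rw [hr, ← Real.rpow_natCast_mul hB.c_pos.le, ← Real.rpow_mul_natCast hB.c_pos.le,
                mul_comm]
      have hle : F [i] (Sword f g l a) ≤
          Real.exp (H / d * r ^ l.length) * F [i] (Sword f g l b) := by
        have h1 := (abs_le.1 (hH i _ hSa _ hSb)).2
        have h2 : H * ‖Sword f g l a - Sword f g l b‖ ^ α ≤ H * r ^ l.length :=
          mul_le_mul_of_nonneg_left hpow hB.H_nonneg
        have h3 := hF i _ hSb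
        have h4 : H * r ^ l.length ≤ H / d * r ^ l.length * F [i] (Sword f g l b) := by
          calc H * r ^ l.length = H / d * r ^ l.length * d := by field_simp
            _ ≤ _ := by gcongr
        have h5 := Real.add_one_le_exp (H / d * r ^ l.length)
        have h6 := mul_le_mul_of_nonneg_right h5 (hd.le.trans h3)
        linarith
      have hpos := pos_of_cons hB hd hnil hcons hF l ha
      rw [hcons i l a, hcons i l b, List.length_cons, Finset.sum_range_succ, mul_add, Real.exp_add]
      calc F [i] (Sword f g l a) * F l a
          ≤ (Real.exp (H / d * r ^ l.length) * F [i] (Sword f g l b)) *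
            (Real.exp (H / d * ∑ j ∈ Finset.range l.length, r ^ j) * F l b) :=
            mul_le_mul hle ih hpos.le (mul_nonneg (Real.exp_pos _).le (hd.le.trans (hF i _ hSb)))
        _ = _ := by ring
  refine ⟨Real.exp (H / d * (1 - r)⁻¹), Real.one_le_exp
    (mul_nonneg hHd (inv_nonneg.2 (sub_nonneg.2 hr1.le))), fun l a ha b hb =>
    (key l a ha b hb).trans ?_⟩
  have hpos := pos_of_cons hB hd hnil hcons hF l hb
  gcongr
  rw [← tsum_geometric_of_lt_one hr0 hr1]
  exact (summable_geometric_of_lt_one hr0 hr1).sum_le_tsum _ fun j _ => pow_nonneg hr0 j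

/-- Bounded distortion makes a cocycle almost multiplicative with a fixed base point. -/
lemma almost_multiplicative (hB : UniformBounds f g α d c η H M) (hd : 0 < d) (hα : 0 < α)
    {F : List ι → ℝ × ℝ → ℝ} (hnil : ∀ a, F [] a = 1)
    (hcons : ∀ i l a, F (i :: l) a = F [i] (Sword f g l a) * F l a)
    (hF : ∀ i, ∀ a ∈ unitSq, d ≤ F [i] a)
    (hH : ∀ i, ∀ a ∈ unitSq, ∀ b ∈ unitSq, |F [i] a - F [i] b| ≤ H * ‖a - b‖ ^ α) :
    ∃ L : ℝ, 1 ≤ L ∧ ∀ u v : List ι, ∀ a ∈ unitSq,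
      F (u ++ v) a ≤ L * (F u a * F v a) ∧ F u a * F v a ≤ L * F (u ++ v) a := by
  obtain ⟨L, hL1, hL⟩ := bounded_distortion hB hd hα hnil hcons hF hH
  refine ⟨L, hL1, fun u v a ha => ?_⟩
  have hpos := pos_of_cons hB hd hnil hcons hF v ha
  have hS := hB.Sword_mem v ha
  rw [append_of_cons hnil hcons, ← mul_assoc, ← mul_assoc]
  exact ⟨mul_le_mul_of_nonneg_right (hL u _ hS _ ha) hpos.le,
    mul_le_mul_of_nonneg_right (hL u _ ha _ hS) hpos.le⟩

end Distortion

section SingularValues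

lemma sv_bounds {A B C M : ℝ} (hA : 0 < A) (hC : 0 < C) (hCA : C ≤ A) (hM : 0 ≤ M)
    (hB : |B| ≤ M * A) :
    (A ≤ (2 + M) * sv1 A B C ∧ sv1 A B C ≤ (2 + M) * A) ∧
      (C ≤ (2 + M) * sv2 A B C ∧ sv2 A B C ≤ (2 + M) * C) := by
  set T := A ^ 2 + B ^ 2 + C ^ 2 with hT
  set D := T ^ 2 - 4 * (A * C) ^ 2 with hD
  have hT0 : 0 < T := by positivity
  have hD0 : 0 ≤ D := by
    have : D = ((A - C) ^ 2 + B ^ 2) * ((A + C) ^ 2 + B ^ 2) := by rw [hD, hT]; ring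
    rw [this]; positivity
  have hs0 : 0 ≤ √D := Real.sqrt_nonneg D
  have hsT : √D ≤ T := by
    rw [Real.sqrt_le_left hT0.le, hD]
    nlinarith [sq_nonneg (A * C)]
  have hss : √D ^ 2 = D := Real.sq_sqrt hD0
  have e1 : sv1 A B C = √((T + √D) / 2) := rfl
  have e2 : sv2 A B C = √((T - √D) / 2) := rfl
  have h1sq : sv1 A B C ^ 2 = (T + √D) / 2 := by rw [e1, Real.sq_sqrt]; positivity
  have h1nn : 0 ≤ sv1 A B C := by rw [e1]; positivity
  have h2nn : 0 ≤ sv2 A B C := by rw [e2]; positivity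
  have hprod : sv1 A B C * sv2 A B C = A * C := by
    rw [e1, e2, ← Real.sqrt_mul (by positivity)]
    have : (T + √D) / 2 * ((T - √D) / 2) = (A * C) ^ 2 := by
      rw [hD] at hss ⊢
      linarith
    rw [this, Real.sqrt_sq (by positivity)]
  have hB2 : B ^ 2 ≤ (M * A) ^ 2 := sq_le_sq' (abs_le.1 hB).1 (abs_le.1 hB).2
  have hC2 : C ^ 2 ≤ A ^ 2 := by gcongr
  have hup : sv1 A B C ≤ (2 + M) * A := by
    refine (sq_le_sq₀ h1nn (by positivity)).1 ?_
    rw [h1sq]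
    nlinarith [mul_nonneg hM (sq_nonneg A), sq_nonneg A]
  have hlow : A ≤ 2 * sv1 A B C := by
    refine (sq_le_sq₀ hA.le (by positivity)).1 ?_
    rw [mul_pow, h1sq]
    nlinarith [sq_nonneg B, sq_nonneg C, sq_nonneg A]
  have h1pos : 0 < sv1 A B C := by linarith
  refine ⟨⟨hlow.trans (by nlinarith), hup⟩, ?_, ?_⟩
  · refine le_of_mul_le_mul_left ?_ hA
    rw [← hprod]
    calc sv1 A B C * sv2 A B C ≤ (2 + M) * A * sv2 A B C := by gcongr
      _ = _ := by ring
  · refine le_of_mul_le_mul_left ?_ h1pos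
    rw [hprod]
    have : A * C ≤ 2 * sv1 A B C * C := by gcongr
    nlinarith [mul_nonneg hM (mul_pos h1pos hC).le]

lemma sv2_one_zero_one : sv2 1 0 1 = 1 := by norm_num [sv2]

lemma rpow_le_of_comparable {x y L : ℝ} (hx : 0 < x) (hy : 0 < y) (hL : 0 < L)
    (hxy : x ≤ L * y) (hyx : y ≤ L * x) (s : ℝ) : x ^ s ≤ L ^ |s| * y ^ s := by
  rcases le_total 0 s with hs | hs
  · rw [abs_of_nonneg hs, ← Real.mul_rpow hL.le hy.le]
    exact Real.rpow_le_rpow hx.le hxy hs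
  · have h1 : (L * x) ^ s ≤ y ^ s := Real.rpow_le_rpow_of_nonpos hy hyx hs
    rw [Real.mul_rpow hL.le hx.le] at h1
    rw [abs_of_nonpos hs, Real.rpow_neg hL.le, inv_mul_eq_div,
      le_div_iff₀ (Real.rpow_pos_of_pos hL s)]
    linarith

end SingularValues

section Words

variable {ι : Type*} {f : ι → ℝ → ℝ} {g : ι → ℝ × ℝ → ℝ} {α d c η H M : ℝ}

lemma UniformBounds.fxw_pos (hB : UniformBounds f g α d c η H M) (hd : 0 < d) (i : ι)
    {a : ℝ × ℝ} (ha : a ∈ unitSq) : 0 < fxw f g [i] a :=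
  pos_of_mul_pos_right (hd.trans_le ((hB.le_gyw i a ha).trans (hB.gyw_le i a ha))) hB.η_nonneg

lemma UniformBounds.gyw_le_fxw (hB : UniformBounds f g α d c η H M) (hd : 0 < d) (i : ι)
    {a : ℝ × ℝ} (ha : a ∈ unitSq) : gyw f g [i] a ≤ fxw f g [i] a :=
  (hB.gyw_le i a ha).trans (mul_le_of_le_one_left (hB.fxw_pos hd i ha).le hB.η_lt_one.le)

lemma UniformBounds.le_fxw (hB : UniformBounds f g α d c η H M) (hd : 0 < d) (i : ι)
    {a : ℝ × ℝ} (ha : a ∈ unitSq) : d ≤ fxw f g [i] a :=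
  (hB.le_gyw i a ha).trans (hB.gyw_le_fxw hd i ha)

/-- The singular values of word Jacobians are comparable to the diagonal entries. -/
lemma UniformBounds.alpha_comparable (hB : UniformBounds f g α d c η H M) (hd : 0 < d)
    (hf : ∀ i, Differentiable ℝ (f i)) (hg : ∀ i, Differentiable ℝ (g i)) :
    ∃ L : ℝ, 1 ≤ L ∧ ∀ l : List ι, ∀ a ∈ unitSq,
      (0 < fxw f g l a ∧ fxw f g l a ≤ L * alphaOne f g l a ∧
        alphaOne f g l a ≤ L * fxw f g l a) ∧
      (0 < gyw f g l a ∧ gyw f g l a ≤ L * alphaTwo f g l a ∧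
        alphaTwo f g l a ≤ L * gyw f g l a) ∧ gyw f g l a ≤ c ^ l.length := by
  have hη : 0 < 1 - η := sub_pos.2 hB.η_lt_one
  set K := M / d / (1 - η) with hK
  have hK0 : 0 ≤ K := div_nonneg (div_nonneg hB.M_nonneg hd.le) hη.le
  have hKeq : M / d + η * K = K := by
    have : K * (1 - η) = M / d := div_mul_cancel₀ _ hη.ne'
    linarith
  refine ⟨2 + K, by linarith, fun l a ha => ?_⟩
  have key : 0 < fxw f g l a ∧ 0 < gyw f g l a ∧ gyw f g l a ≤ fxw f g l a ∧
      fxw f g l a ≤ c ^ l.length ∧ |gxw f g l a| ≤ K * fxw f g l a := by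
    induction l with
    | nil => simp [fxw_nil, gyw_nil, gxw_nil, hK0]
    | cons i l ih =>
      obtain ⟨hA, hC, hCA, hAc, hBK⟩ := ih
      have hS := hB.Sword_mem l ha
      have hi := hB.fxw_pos hd i hS
      have hgi : 0 < gyw f g [i] (Sword f g l a) := hd.trans_le (hB.le_gyw i _ hS)
      rw [fxw_cons hf hg, gyw_cons hf hg, gxw_cons hf hg]
      refine ⟨mul_pos hi hA, mul_pos hgi hC,
        mul_le_mul (hB.gyw_le_fxw hd i hS) hCA hC.le hi.le, ?_, ?_⟩
      · rw [List.length_cons, pow_succ']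
        exact mul_le_mul (hB.fxw_le i _ hS) hAc hA.le hB.c_pos.le
      · calc |gxw f g [i] (Sword f g l a) * fxw f g l a +
              gyw f g [i] (Sword f g l a) * gxw f g l a|
            ≤ |gxw f g [i] (Sword f g l a)| * fxw f g l a +
              gyw f g [i] (Sword f g l a) * |gxw f g l a| := by
              refine (abs_add_le _ _).trans ?_
              rw [abs_mul, abs_mul, abs_of_pos hA, abs_of_pos hgi]
          _ ≤ (M / d * fxw f g [i] (Sword f g l a)) * fxw f g l a +
              (η * fxw f g [i] (Sword f g l a)) * (K * fxw f g l a) := by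
              have h1 : M ≤ M / d * fxw f g [i] (Sword f g l a) := by
                calc M = M / d * d := by field_simp
                  _ ≤ _ := mul_le_mul_of_nonneg_left (hB.le_fxw hd i hS)
                    (div_nonneg hB.M_nonneg hd.le)
              have h2 := (hB.gxw_le i _ hS).trans h1
              have h3 := hB.gyw_le i _ hS
              gcongr
              exact hgi.le.trans h3
          _ = (M / d + η * K) * (fxw f g [i] (Sword f g l a) * fxw f g l a) := by ring
          _ = K * (fxw f g [i] (Sword f g l a) * fxw f g l a) := by rw [hKeq]
  obtain ⟨hA, hC, hCA, hAc, hBK⟩ := key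
  obtain ⟨h1, h2⟩ := sv_bounds hA hC hCA hK0 hBK
  exact ⟨⟨hA, h1⟩, ⟨hC, h2⟩, hCA.trans hAc⟩

lemma almost_multiplicative_of_comparable {X F : List ι → ℝ} {L L' : ℝ} (hL : 1 ≤ L)
    (hL' : 1 ≤ L') (hF : ∀ l, 0 < F l ∧ F l ≤ L * X l ∧ X l ≤ L * F l)
    (hmul : ∀ u v, F (u ++ v) ≤ L' * (F u * F v) ∧ F u * F v ≤ L' * F (u ++ v)) (u v : List ι) :
    X (u ++ v) ≤ L ^ 3 * L' * (X u * X v) ∧ X u * X v ≤ L ^ 3 * L' * X (u ++ v) := by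
  have hL0 : 0 < L := by linarith
  have hX : ∀ l, 0 < X l := fun l => pos_of_mul_pos_right ((hF l).1.trans_le (hF l).2.1) hL0.le
  have hu := hF u
  have hv := hF v
  have huv := hF (u ++ v)
  constructor
  · calc X (u ++ v) ≤ L * F (u ++ v) := huv.2.2
      _ ≤ L * (L' * (F u * F v)) := by gcongr; exact (hmul u v).1
      _ ≤ L * (L' * ((L * X u) * (L * X v))) := by
          gcongr
          · exact hv.1.le
          · exact mul_nonneg hL0.le (hX u).le
          · exact hu.2.1
          · exact hv.2.1
      _ = _ := by ring
  · calc X u * X v ≤ (L * F u) * (L * F v) :=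
          mul_le_mul hu.2.2 hv.2.2 (hX v).le (mul_nonneg hL0.le hu.1.le)
      _ = L ^ 2 * (F u * F v) := by ring
      _ ≤ L ^ 2 * (L' * F (u ++ v)) :=
          mul_le_mul_of_nonneg_left (hmul u v).2 (by positivity)
      _ ≤ L ^ 2 * (L' * (L * X (u ++ v))) := by gcongr; exact huv.2.1
      _ = _ := by ring

lemma pword_pos {p : ι → ℝ} (hp : ∀ i, 0 < p i) (l : List ι) : 0 < pword p l :=
  List.prod_pos fun x hx => by
    obtain ⟨i, -, rfl⟩ := List.mem_map.1 hx
    exact hp i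

lemma pword_append (p : ι → ℝ) (u v : List ι) : pword p (u ++ v) = pword p u * pword p v := by
  simp [pword]

lemma psiSV_pos {p : ι → ℝ} (hp : ∀ i, 0 < p i) {a : ℝ × ℝ} {l : List ι}
    (h1 : 0 < alphaOne f g l a) (h2 : 0 < alphaTwo f g l a) (s q b : ℝ) :
    0 < psiSV f g p s q b a l :=
  mul_pos (mul_pos (Real.rpow_pos_of_pos (pword_pos hp l) _) (Real.rpow_pos_of_pos h1 _))
    (Real.rpow_pos_of_pos h2 _)

/-- The modified singular value function is submultiplicative up to a constant. -/
lemma psiSV_append_le {p : ι → ℝ} (hp : ∀ i, 0 < p i) {a : ℝ × ℝ} {L₁ L₂ : ℝ}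
    (hL₁ : 0 < L₁) (hL₂ : 0 < L₂)
    (hpos : ∀ l, 0 < alphaOne f g l a ∧ 0 < alphaTwo f g l a)
    (h1 : ∀ u v, alphaOne f g (u ++ v) a ≤ L₁ * (alphaOne f g u a * alphaOne f g v a) ∧
      alphaOne f g u a * alphaOne f g v a ≤ L₁ * alphaOne f g (u ++ v) a)
    (h2 : ∀ u v, alphaTwo f g (u ++ v) a ≤ L₂ * (alphaTwo f g u a * alphaTwo f g v a) ∧
      alphaTwo f g u a * alphaTwo f g v a ≤ L₂ * alphaTwo f g (u ++ v) a)
    (s q b : ℝ) (u v : List ι) :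
    psiSV f g p s q b a (u ++ v) ≤
      L₁ ^ |b| * L₂ ^ |s - b| * (psiSV f g p s q b a u * psiSV f g p s q b a v) := by
  obtain ⟨hu1, hu2⟩ := hpos u
  obtain ⟨hv1, hv2⟩ := hpos v
  obtain ⟨huv1, huv2⟩ := hpos (u ++ v)
  have e1 := rpow_le_of_comparable huv1 (mul_pos hu1 hv1) hL₁ (h1 u v).1 (h1 u v).2 b
  have e2 := rpow_le_of_comparable huv2 (mul_pos hu2 hv2) hL₂ (h2 u v).1 (h2 u v).2 (s - b)
  rw [Real.mul_rpow hu1.le hv1.le] at e1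
  rw [Real.mul_rpow hu2.le hv2.le] at e2
  have hpu := pword_pos hp u
  have hpv := pword_pos hp v
  unfold psiSV
  rw [pword_append, Real.mul_rpow hpu.le hpv.le]
  calc _ ≤ pword p u ^ q * pword p v ^ q *
        (L₁ ^ |b| * (alphaOne f g u a ^ b * alphaOne f g v a ^ b)) *
        (L₂ ^ |s - b| * (alphaTwo f g u a ^ (s - b) * alphaTwo f g v a ^ (s - b))) := by
        gcongr
    _ = _ := by ring

end Words

section Counting

variable {ι : Type*} [Fintype ι]

/-- A renewal argument: if `φ` is submultiplicative up to `L`, its word sums are unbounded, and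
every word of length `N` has a nonempty prefix in the finite set `T`, then the sum of `φ` over
`T` is at least `L⁻¹`. -/
lemma inv_le_sum_of_prefix {φ : List ι → ℝ} {L : ℝ} (hL : 0 < L) (hφ : ∀ l, 0 ≤ φ l)
    (hsub : ∀ u v, φ (u ++ v) ≤ L * (φ u * φ v))
    (hunb : ∀ B : ℝ, ∃ n : ℕ, B < ∑ w : Fin n → ι, φ (List.ofFn w))
    (T : Finset (List ι)) (hT : ∀ u ∈ T, u ≠ []) (N : ℕ)
    (hpre : ∀ w : List ι, N ≤ w.length → ∃ u ∈ T, ∃ v, w = u ++ v) :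
    L⁻¹ ≤ ∑ u ∈ T, φ u := by
  by_contra! hlt
  set W : ℕ → ℝ := fun n => ∑ w : Fin n → ι, φ (List.ofFn w) with hW
  have hW0 : ∀ n, 0 ≤ W n := fun n => Finset.sum_nonneg fun w _ => hφ _
  have hstep : ∀ n, N ≤ n → W n ≤ ∑ u ∈ T, L * (φ u * W (n - u.length)) := by
    intro n hn
    have hex : ∀ w : Fin n → ι, ∃ x : (Σ u : T, (Fin (n - u.1.length) → ι)),
        x.1.1 ++ List.ofFn x.2 = List.ofFn w := by
      intro w
      obtain ⟨u, hu, v, hv⟩ := hpre (List.ofFn w) (by simpa using hn)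
      have hlen : v.length = n - u.length := by
        have := congrArg List.length hv
        rw [List.length_ofFn, List.length_append] at this
        omega
      refine ⟨⟨⟨u, hu⟩, fun j => v.get (j.cast hlen.symm)⟩, ?_⟩
      have : List.ofFn (fun j : Fin (n - u.length) => v.get (j.cast hlen.symm)) = v := by
        apply List.ext_get
        · simp [hlen]
        · intro k h1 h2
          simp
      rw [hv]
      exact congrArg (u ++ ·) this
    choose e he using hex
    have hinj : Function.Injective e := fun w w' hww => by
      apply List.ofFn_injective
      rw [← he w, ← he w', hww]
    calc W n = ∑ w : Fin n → ι, φ ((e w).1.1 ++ List.ofFn (e w).2) := by simp only [hW, he]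
      _ = ∑ x ∈ Finset.univ.map ⟨e, hinj⟩, φ (x.1.1 ++ List.ofFn x.2) := by
          rw [Finset.sum_map]; rfl
      _ ≤ ∑ x : (Σ u : T, (Fin (n - u.1.length) → ι)), φ (x.1.1 ++ List.ofFn x.2) :=
          Finset.sum_le_univ_sum_of_nonneg fun x => hφ _
      _ = ∑ u : T, ∑ v : Fin (n - u.1.length) → ι, φ (u.1 ++ List.ofFn v) :=
          Fintype.sum_sigma _
      _ ≤ ∑ u : T, L * (φ u.1 * W (n - u.1.length)) := by
          refine Finset.sum_le_sum fun u _ => ?_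
          rw [hW, Finset.mul_sum, Finset.mul_sum]
          exact Finset.sum_le_sum fun v _ => hsub _ _
      _ = ∑ u ∈ T, L * (φ u * W (n - u.length)) :=
          Finset.sum_coe_sort T fun u => L * (φ u * W (n - u.length))
  set B := ∑ m ∈ Finset.range (N + 1), W m with hBdef
  have hB0 : 0 ≤ B := Finset.sum_nonneg fun m _ => hW0 m
  have hbound : ∀ n, W n ≤ B := by
    intro n
    induction n using Nat.strong_induction_on with
    | _ n ih =>
      rcases Nat.lt_or_ge n (N + 1) with hn | hn
      · exact Finset.single_le_sum (f := W) (fun m _ => hW0 m) (Finset.mem_range.2 hn)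
      · calc W n ≤ ∑ u ∈ T, L * (φ u * W (n - u.length)) := hstep n (by omega)
          _ ≤ ∑ u ∈ T, L * (φ u * B) := by
              refine Finset.sum_le_sum fun u hu => ?_
              have h1 : 0 < u.length := List.length_pos_iff.2 (hT u hu)
              have h2 := ih (n - u.length) (by omega)
              have h3 := hφ u
              gcongr
          _ = L * (∑ u ∈ T, φ u) * B := by rw [← Finset.mul_sum, ← Finset.sum_mul, mul_assoc]
          _ ≤ 1 * B := by
              gcongr
              calc L * ∑ u ∈ T, φ u ≤ L * L⁻¹ := by gcongr
                _ = 1 := mul_inv_cancel₀ hL.ne'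
          _ = B := one_mul B
  obtain ⟨n, hn⟩ := hunb B
  exact (hbound n).not_gt hn

end Counting

lemma exists_prefix_mem_stopping {ι : Type*} {f : ι → ℝ → ℝ} {g : ι → ℝ × ℝ → ℝ} {a : ℝ × ℝ}
    {δ : ℝ} (hδ : δ ≤ 1) {w : List ι} (hw : alphaTwo f g w a < δ) :
    ∃ u ∈ stopping f g a δ, ∃ v, w = u ++ v := by
  have hnil : alphaTwo f g [] a = 1 := by
    rw [alphaTwo, fxw_nil, gxw_nil, gyw_nil, sv2_one_zero_one]
  have hex : ∃ k, alphaTwo f g (w.take k) a < δ := ⟨w.length, by rwa [List.take_length]⟩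
  have hk := Nat.find_spec hex
  have hkmin := fun m => Nat.find_min hex (m := m)
  have hkle : Nat.find hex ≤ w.length := Nat.find_min' hex (by rwa [List.take_length])
  set k := Nat.find hex
  have hk0 : k ≠ 0 := by
    intro h0
    rw [h0, List.take_zero, hnil] at hk
    linarith
  refine ⟨w.take k, ⟨?_, hk, ?_⟩, w.drop k, (List.take_append_drop k w).symm⟩
  · intro h0
    rw [h0, hnil] at hk
    linarith
  · have h1 : (w.take k).dropLast = w.take (k - 1) := by
      rw [List.dropLast_eq_take, List.take_take, List.length_take]
      congr 1
      omega
    rw [h1]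
    exact not_lt.1 (hkmin (k - 1) (by omega))

lemma PsiSum_unbounded {ι : Type*} [Fintype ι] {f : ι → ℝ → ℝ} {g : ι → ℝ × ℝ → ℝ} {p : ι → ℝ}
    {a : ℝ × ℝ} {s t q b c L : ℝ} (hp : ∀ i, 0 < p i) (hc0 : 0 < c) (hc1 : c < 1) (hL : 0 < L)
    (hpos : ∀ l, 0 < alphaOne f g l a ∧ 0 < alphaTwo f g l a)
    (hup : ∀ l : List ι, alphaTwo f g l a ≤ L * c ^ l.length) (hts : t < s)
    (hlim : Tendsto (fun k : ℕ => PsiSum f g p s q b a k ^ ((k : ℝ)⁻¹)) atTop (𝓝 1)) (B : ℝ) :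
    ∃ n, B < PsiSum f g p t q b a n := by
  by_contra! hB
  set r := s - t with hr
  have hr0 : 0 < r := sub_pos.2 hts
  have hle : ∀ n, PsiSum f g p s q b a n ≤ (|B| + 1) * L ^ r * (c ^ r) ^ n := by
    intro n
    have h1 : PsiSum f g p s q b a n ≤ PsiSum f g p t q b a n * (L * c ^ n) ^ r := by
      unfold PsiSum
      rw [Finset.sum_mul]
      refine Finset.sum_le_sum fun w _ => ?_
      obtain ⟨h1, h2⟩ := hpos (List.ofFn w)
      have h3 : alphaTwo f g (List.ofFn w) a ^ r ≤ (L * c ^ n) ^ r :=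
        Real.rpow_le_rpow h2.le (by simpa using hup (List.ofFn w)) hr0.le
      have h4 : psiSV f g p s q b a (List.ofFn w) =
          psiSV f g p t q b a (List.ofFn w) * alphaTwo f g (List.ofFn w) a ^ r := by
        rw [psiSV, psiSV, mul_assoc _ (_ ^ (t - b)), ← Real.rpow_add h2]
        congr 2
        rw [hr]; ring
      rw [h4]
      exact mul_le_mul_of_nonneg_left h3 (psiSV_pos hp h1 h2 _ _ _).le
    refine h1.trans ?_
    rw [Real.mul_rpow hL.le (by positivity), mul_assoc, ← Real.rpow_natCast_mul hc0.le,
      ← Real.rpow_mul_natCast hc0.le, mul_comm (n : ℝ) r]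
    have h5 := (hB n).trans ((le_abs_self B).trans (le_add_of_nonneg_right zero_le_one))
    gcongr
  set D := (|B| + 1) * L ^ r with hD
  have hD0 : 0 < D := mul_pos (by positivity) (Real.rpow_pos_of_pos hL r)
  have hinv : Tendsto (fun k : ℕ => ((k : ℝ)⁻¹)) atTop (𝓝 0) := tendsto_inv_atTop_nhds_zero_nat
  have hlim2 : Tendsto (fun k : ℕ => D ^ ((k : ℝ)⁻¹) * c ^ r) atTop (𝓝 (D ^ (0:ℝ) * c ^ r)) :=
    (((Real.continuous_const_rpow hD0.ne').tendsto 0).comp hinv).mul_const _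
  rw [Real.rpow_zero, one_mul] at hlim2
  have hcr : 0 ≤ c ^ r := Real.rpow_nonneg hc0.le r
  refine (Real.rpow_lt_one hc0.le hc1 hr0).not_ge (le_of_tendsto_of_tendsto hlim hlim2 ?_)
  filter_upwards [eventually_ne_atTop 0] with k hk
  calc PsiSum f g p s q b a k ^ ((k : ℝ)⁻¹) ≤ (D * (c ^ r) ^ k) ^ ((k : ℝ)⁻¹) := by
        refine Real.rpow_le_rpow (Finset.sum_nonneg fun w _ => ?_) (hle k) (by positivity)
        exact (psiSV_pos hp (hpos _).1 (hpos _).2 _ _ _).le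
    _ = D ^ ((k : ℝ)⁻¹) * c ^ r := by
        rw [Real.mul_rpow hD0.le (by positivity), Real.pow_rpow_inv_natCast hcr hk]

theorem stopping_sum_lower {ι : Type*} [Fintype ι]
    (f : ι → ℝ → ℝ) (g : ι → ℝ × ℝ → ℝ) (α d : ℝ) (h : IFSHyp f g α d)
    (p : ι → ℝ) (hp : ProbVec p)
    (μ : Measure (ℝ × ℝ)) [IsProbabilityMeasure μ]
    (hμ : μ = ∑ i : ι, ENNReal.ofReal (p i) • μ.map (Smap f g i))
    (β : ℝ → ℝ)
    (hβ : ∀ q : ℝ, 0 ≤ q → Tendsto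
      (fun δ => Real.log (msum1 (μ.map Prod.fst) q δ) / (-Real.log δ)) (𝓝[>] (0:ℝ)) (𝓝 (β q)))
    (P : ℝ → ℝ → ℝ)
    (hP : ∀ s q : ℝ, 0 ≤ q → ∀ a ∈ unitSq,
      Tendsto (fun k : ℕ => PsiSum f g p s q (β q) a k ^ ((k : ℝ)⁻¹)) atTop (𝓝 (P s q)))
    (γ : ℝ → ℝ) (hγ : ∀ q : ℝ, 0 ≤ q → P (γ q) q = 1)
    (a : ℝ × ℝ) (ha : a ∈ unitSq) (q t : ℝ) (hq : 0 ≤ q) (ht : t < γ q) :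
    ∃ K : ℝ, 0 < K ∧ ∀ δ : ℝ, 0 < δ → δ ≤ 1 →
      K ≤ ∑' l : {l : List ι // l ∈ stopping f g a δ}, psiSV f g p t q (β q) a l.1 := by
  obtain ⟨c, η, H, M, hB⟩ := exists_uniformBounds h
  have hd := h.d_pos
  have hf := h.diff_f
  have hg := h.diff_g
  obtain ⟨L, hL1, hL⟩ := hB.alpha_comparable hd hf hg
  have hL0 : 0 < L := by linarith
  obtain ⟨L₁, hL₁1, hL₁⟩ := almost_multiplicative hB hd h.alpha_pos (F := fxw f g)
    fxw_nil (fxw_cons hf hg) (fun i _ hb => hB.le_fxw hd i hb) hB.holder_fxw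
  obtain ⟨L₂, hL₂1, hL₂⟩ := almost_multiplicative hB hd h.alpha_pos (F := gyw f g)
    gyw_nil (gyw_cons hf hg) hB.le_gyw hB.holder_gyw
  have hα₁ := almost_multiplicative_of_comparable (X := fun l => alphaOne f g l a)
    (F := fun l => fxw f g l a) hL1 hL₁1 (fun l => (hL l a ha).1) (fun u v => hL₁ u v a ha)
  have hα₂ := almost_multiplicative_of_comparable (X := fun l => alphaTwo f g l a)
    (F := fun l => gyw f g l a) hL1 hL₂1 (fun l => (hL l a ha).2.1) (fun u v => hL₂ u v a ha)
  have hpos : ∀ l, 0 < alphaOne f g l a ∧ 0 < alphaTwo f g l a := fun l =>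
    ⟨pos_of_mul_pos_right ((hL l a ha).1.1.trans_le (hL l a ha).1.2.1) hL0.le,
      pos_of_mul_pos_right ((hL l a ha).2.1.1.trans_le (hL l a ha).2.1.2.1) hL0.le⟩
  have hup : ∀ l : List ι, alphaTwo f g l a ≤ L * c ^ l.length := fun l =>
    (hL l a ha).2.1.2.2.trans (mul_le_mul_of_nonneg_left (hL l a ha).2.2 hL0.le)
  have hp0 : ∀ i, 0 < p i := fun i => (hp.1 i).1
  have hlim := hP (γ q) q hq a ha
  rw [hγ q hq] at hlim
  have hC : 0 < (L ^ 3 * L₁) ^ |β q| * (L ^ 3 * L₂) ^ |t - β q| := by positivity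
  refine ⟨_, inv_pos.2 hC, fun δ hδ0 hδ1 => ?_⟩
  obtain ⟨N, hN⟩ : ∃ N : ℕ, ∀ n, N ≤ n → L * c ^ n < δ := by
    have h1 : Tendsto (fun n : ℕ => L * c ^ n) atTop (𝓝 (L * 0)) :=
      (tendsto_pow_atTop_nhds_zero_of_lt_one hB.c_pos.le hB.c_lt_one).const_mul L
    rw [mul_zero] at h1
    exact eventually_atTop.1 (h1.eventually_lt_const hδ0)
  have hfin : (stopping f g a δ).Finite := by
    refine (List.finite_length_le ι N).subset fun l hl => ?_
    by_contra hlen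
    have h1 : N ≤ l.dropLast.length := by
      rw [List.length_dropLast]
      simp only [Set.mem_ofPred_eq] at hlen
      omega
    exact ((hup l.dropLast).trans_lt (hN _ h1)).not_ge hl.2.2
  have key := inv_le_sum_of_prefix (φ := psiSV f g p t q (β q) a) hC
    (fun l => (psiSV_pos hp0 (hpos l).1 (hpos l).2 _ _ _).le)
    (psiSV_append_le hp0 (by positivity) (by positivity) hpos hα₁ hα₂ t q (β q))
    (PsiSum_unbounded hp0 hB.c_pos hB.c_lt_one hL0 hpos hup ht hlim)
    hfin.toFinset (fun u hu => (hfin.mem_toFinset.1 hu).1) N (fun w hw => by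
      simpa only [hfin.mem_toFinset] using
        exists_prefix_mem_stopping hδ1 ((hup w).trans_lt (hN _ hw)))
  refine key.trans (le_of_eq ?_)
  rw [← Finset.tsum_subtype', hfin.coe_toFinset]

end
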